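/- arXiv:2603.26455 — 4 statements merged into one kernel-verified Lean document; each statement's English description precedes it below -/
import Mathlib

section
/- Let B be a regular magnetic field on ℝ^d, A the transversal gauge potential, and φ the circulation of A along line segments. Then φ is smooth on ℝ^d × ℝ^d and for every j ∈ {1,…,d} and all x, y ∈ ℝ^d one has ∂_{x_j} φ(x,y) − A_j(x) = −A_j(x;y). -/
open MeasureTheory Filter
open scoped ENNReal

noncomputable section

/-- Japanese bracket `⟨v⟩ = √(1+‖v‖²)` with the Euclidean norm on `ℝ^N`. -/
def jbV {N : ℕ} (v : Fin N → ℝ) : ℝ := Real.sqrt (1 + ∑ i, v i ^ 2)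

/-- A tempered weight on `ℝ^N`: a positive function `m` with
`m(u+v) ≤ C·m(u)·⟨v⟩^a` for some `C, a > 0`. -/
def IsTemperedWeight {N : ℕ} (m : (Fin N → ℝ) → ℝ) : Prop :=
  (∀ u, 0 < m u) ∧ ∃ C > 0, ∃ a : ℝ, 0 < a ∧ ∀ u v, m (u + v) ≤ C * m u * jbV v ^ a

/-- A regular magnetic field on `ℝ^d`: smooth, antisymmetric, closed, with all
derivatives of all components bounded. -/
structure IsRegularMagneticField (d : ℕ) (B : Fin d → Fin d → (Fin d → ℝ) → ℝ) : Prop where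
  smooth : ∀ j k, ContDiff ℝ (⊤ : ℕ∞) (B j k)
  antisymm : ∀ j k x, B j k x = - B k j x
  closed : ∀ i j k, ∀ x : Fin d → ℝ,
      fderiv ℝ (B j k) x (Pi.single i 1) + fderiv ℝ (B k i) x (Pi.single j 1)
        + fderiv ℝ (B i j) x (Pi.single k 1) = 0
  derivBounded : ∀ j k, ∀ n : ℕ, ∃ C : ℝ, ∀ x, ‖iteratedFDeriv ℝ n (B j k) x‖ ≤ C

/-- The transversal-gauge vector potential based at `y`:
`A_k(x;y) = Σ_j ∫₀¹ s·(x_j−y_j)·B_{jk}(y+s(x−y)) ds`. -/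
def magA (d : ℕ) (B : Fin d → Fin d → (Fin d → ℝ) → ℝ) (y x : Fin d → ℝ) (k : Fin d) : ℝ :=
  ∑ j, ∫ s in (0:ℝ)..1, s * (x j - y j) * B j k (y + s • (x - y))

/-- The circulation `φ(x,y) = Σ_k ∫₀¹ A_k(y+s(x−y))·(x_k−y_k) ds` of `A = A(·;0)`
along the segment from `y` to `x`. -/
def magPhi (d : ℕ) (B : Fin d → Fin d → (Fin d → ℝ) → ℝ) (x y : Fin d → ℝ) : ℝ :=
  ∑ k, ∫ s in (0:ℝ)..1, magA d B 0 (y + s • (x - y)) k * (x k - y k)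

/-- A window function for the magnetic Gabor frame: smooth, compactly supported in
`(−1,1)^d`, with `Σ_{α∈ℤ^d} 𝔤(x−α)² = 1`. -/
structure IsWindow (d : ℕ) (g : (Fin d → ℝ) → ℝ) : Prop where
  smooth : ContDiff ℝ (⊤ : ℕ∞) g
  compactSupport : HasCompactSupport g
  support_subset : ∀ x : Fin d → ℝ, g x ≠ 0 → ∀ i, |x i| < 1
  partition : ∀ x : Fin d → ℝ, ∑' α : Fin d → ℤ, (g (x - fun i => (α i : ℝ))) ^ 2 = 1

abbrev Idx (d : ℕ) := (Fin d → ℤ) × (Fin d → ℤ)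
abbrev Idx2 (d : ℕ) := Idx d × Idx d
abbrev E1 (d : ℕ) := Fin d → ℝ
abbrev E2 (d : ℕ) := E1 d × E1 d
abbrev E4 (d : ℕ) := E2 d × E2 d

/-- The magnetic Gabor function
`𝒢_α̃(x) = (2π)^{−d/2}·e^{iφ(x,α)}·𝔤(x−α)·e^{iα'·(x−α)}` for `α̃ = (α,α')`. -/
def gabor (d : ℕ) (B : Fin d → Fin d → E1 d → ℝ) (g : E1 d → ℝ) (a : Idx d) (x : E1 d) : ℂ :=
  (((2 * Real.pi) ^ (-(d : ℝ) / 2) : ℝ) : ℂ) *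
    Complex.exp (Complex.I * (magPhi d B x (fun i => (a.1 i : ℝ)) : ℂ)) *
    ((g (x - fun i => (a.1 i : ℝ)) : ℝ) : ℂ) *
    Complex.exp (Complex.I * ((∑ i, (a.2 i : ℝ) * (x i - (a.1 i : ℝ)) : ℝ) : ℂ))

/-- `G_{α̃,β̃}(x,y) = 𝒢_α̃(x)·conj(𝒢_β̃(y))`. -/
def gaborTensor (d : ℕ) (B : Fin d → Fin d → E1 d → ℝ) (g : E1 d → ℝ) (a b : Idx d)
    (p : E2 d) : ℂ :=
  gabor d B g a p.1 * (starRingEnd ℂ) (gabor d B g b p.2)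

/-- `T_{α̃,β̃}(x,y) = conj(𝒢_α̃(x))·𝒢_β̃(y)`. -/
def gaborDual (d : ℕ) (B : Fin d → Fin d → E1 d → ℝ) (g : E1 d → ℝ) (a b : Idx d)
    (p : E2 d) : ℂ :=
  (starRingEnd ℂ) (gabor d B g a p.1) * gabor d B g b p.2

/-- The frame coefficient `c_{α̃,β̃}(F) = ∫ F(x,y)·conj(𝒢_α̃(x))·𝒢_β̃(y) dx dy`. -/
def frameCoef (d : ℕ) (B : Fin d → Fin d → E1 d → ℝ) (g : E1 d → ℝ) (a b : Idx d)
    (F : E2 d → ℂ) : ℂ :=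
  ∫ p : E2 d, F p * (starRingEnd ℂ) (gabor d B g a p.1) * gabor d B g b p.2

/-- `⟨(α̃,β̃)⟩` with `(α̃,β̃)` regarded as a point of `ℝ^{4d}`. -/
def jbIdxPair (d : ℕ) (a b : Idx d) : ℝ :=
  Real.sqrt (1 + (∑ i, ((a.1 i : ℝ)) ^ 2) + (∑ i, ((a.2 i : ℝ)) ^ 2)
    + (∑ i, ((b.1 i : ℝ)) ^ 2) + ∑ i, ((b.2 i : ℝ)) ^ 2)

/-- Euclidean Japanese bracket on `ℝ^{4d} = E4 d`. -/
def jbE4 (d : ℕ) (v : E4 d) : ℝ :=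
  Real.sqrt (1 + (∑ i, v.1.1 i ^ 2) + (∑ i, v.1.2 i ^ 2) + (∑ i, v.2.1 i ^ 2) + ∑ i, v.2.2 i ^ 2)

/-- A tempered weight on `ℝ^{4d}`. -/
def IsTemperedWeightE4 (d : ℕ) (M : E4 d → ℝ) : Prop :=
  (∀ u, 0 < M u) ∧ ∃ C > 0, ∃ a : ℝ, 0 < a ∧ ∀ u v, M (u + v) ≤ C * M u * jbE4 d v ^ a

/-- Euclidean Japanese bracket on `ℝ^N × ℝ^N`. -/
def jbP {N : ℕ} (v : (Fin N → ℝ) × (Fin N → ℝ)) : ℝ :=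
  Real.sqrt (1 + (∑ i, v.1 i ^ 2) + ∑ i, v.2 i ^ 2)

/-- A tempered weight on `ℝ^N × ℝ^N ≅ ℝ^{2N}`. -/
def IsTemperedWeightProd {N : ℕ} (m : (Fin N → ℝ) × (Fin N → ℝ) → ℝ) : Prop :=
  (∀ u, 0 < m u) ∧ ∃ C > 0, ∃ a : ℝ, 0 < a ∧ ∀ u v, m (u + v) ≤ C * m u * jbP v ^ a

/-- `⟨(α̃,β̃) − (γ̃,δ̃)⟩` for pairs of indices in `ℤ^{2d} × ℤ^{2d}`. -/
def jbDiffIdx2 (d : ℕ) (p q : Idx2 d) : ℝ :=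
  Real.sqrt (1 + (∑ i, ((p.1.1 i - q.1.1 i : ℤ) : ℝ) ^ 2) + (∑ i, ((p.1.2 i - q.1.2 i : ℤ) : ℝ) ^ 2)
    + (∑ i, ((p.2.1 i - q.2.1 i : ℤ) : ℝ) ^ 2) + ∑ i, ((p.2.2 i - q.2.2 i : ℤ) : ℝ) ^ 2)

/-- The midpoint `((α̃,β̃)+(γ̃,δ̃))/2 ∈ ℝ^{4d}`. -/
def midIdx2 (d : ℕ) (p q : Idx2 d) : E4 d :=
  ((fun i => ((p.1.1 i + q.1.1 i : ℤ) : ℝ) / 2, fun i => ((p.1.2 i + q.1.2 i : ℤ) : ℝ) / 2),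
   (fun i => ((p.2.1 i + q.2.1 i : ℤ) : ℝ) / 2, fun i => ((p.2.2 i + q.2.2 i : ℤ) : ℝ) / 2))

/-- Membership in the Hörmander class `S₀(M)` on `ℝ^{4d}`: smooth, with all
derivatives dominated by `M`. -/
def InS0 (d : ℕ) (M : E4 d → ℝ) (Φ : E4 d → ℂ) : Prop :=
  ContDiff ℝ (⊤ : ℕ∞) Φ ∧ ∀ n : ℕ, ∃ C : ℝ, ∀ X, ‖iteratedFDeriv ℝ n Φ X‖ ≤ C * M X

/-- The seminorms `‖Φ‖_{S₀(M),k}`. -/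
def s0Seminorm (d : ℕ) (M : E4 d → ℝ) (k : ℕ) (Φ : E4 d → ℂ) : ℝ :=
  ∑ n ∈ Finset.range (k + 1), ⨆ X : E4 d, ‖iteratedFDeriv ℝ n Φ X‖ / M X

/-- The integrand of the inner (oscillatory) integral defining `H_{(α̃,β̃),(γ̃,δ̃)}`,
evaluated at `X = ((v_L,ξ_L),(v_R,ξ_R))` and `z = (z_L,z_R)`. -/
def gaborKernel4 (d : ℕ) (B : Fin d → Fin d → E1 d → ℝ) (g : E1 d → ℝ) (ab gd : Idx2 d)
    (X : E4 d) (z : E2 d) : ℂ :=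
  Complex.exp (Complex.I * (((∑ i, X.1.2 i * z.1 i) - ∑ i, X.2.2 i * z.2 i : ℝ) : ℂ)) *
  Complex.exp (Complex.I * ((magPhi d B (X.1.1 + (2 : ℝ)⁻¹ • z.1) (X.1.1 - (2 : ℝ)⁻¹ • z.1)
      - magPhi d B (X.2.1 + (2 : ℝ)⁻¹ • z.2) (X.2.1 - (2 : ℝ)⁻¹ • z.2) : ℝ) : ℂ)) *
  gabor d B g gd.1 (X.1.1 + (2 : ℝ)⁻¹ • z.1) *
  (starRingEnd ℂ) (gabor d B g gd.2 (X.2.1 + (2 : ℝ)⁻¹ • z.2)) *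
  (starRingEnd ℂ) (gabor d B g ab.1 (X.1.1 - (2 : ℝ)⁻¹ • z.1)) *
  gabor d B g ab.2 (X.2.1 - (2 : ℝ)⁻¹ • z.2)

/-- The kernel `H_{(α̃,β̃),(γ̃,δ̃)}` on `ℝ^{4d}`. -/
def matH (d : ℕ) (B : Fin d → Fin d → E1 d → ℝ) (g : E1 d → ℝ) (ab gd : Idx2 d)
    (X : E4 d) : ℂ :=
  (((2 * Real.pi) ^ (-(2 * (d : ℝ))) : ℝ) : ℂ) * ∫ z : E2 d, gaborKernel4 d B g ab gd X z

/-- The matrix element `𝕄_{(α̃,β̃),(γ̃,δ̃)}[Φ] = ∫ Φ·H_{(α̃,β̃),(γ̃,δ̃)}`. -/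
def matElem (d : ℕ) (B : Fin d → Fin d → E1 d → ℝ) (g : E1 d → ℝ) (Φ : E4 d → ℂ)
    (ab gd : Idx2 d) : ℂ :=
  ∫ X : E4 d, Φ X * matH d B g ab gd X

/-- The dequantized frame symbol
`g_{α̃,γ̃}(v,ξ) = ∫ e^{−iξ·z}·e^{−iφ(v+z/2,v−z/2)}·𝒢_α̃(v+z/2)·conj(𝒢_γ̃(v−z/2)) dz`. -/
def deqSymbol (d : ℕ) (B : Fin d → Fin d → E1 d → ℝ) (g : E1 d → ℝ) (ac : Idx d × Idx d)
    (vξ : E2 d) : ℂ :=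
  ∫ z : E1 d,
    Complex.exp (-Complex.I * ((∑ i, vξ.2 i * z i : ℝ) : ℂ)) *
    Complex.exp (-Complex.I * ((magPhi d B (vξ.1 + (2 : ℝ)⁻¹ • z) (vξ.1 - (2 : ℝ)⁻¹ • z) : ℝ) : ℂ)) *
    gabor d B g ac.1 (vξ.1 + (2 : ℝ)⁻¹ • z) *
    (starRingEnd ℂ) (gabor d B g ac.2 (vξ.1 - (2 : ℝ)⁻¹ • z))

open scoped ContDiff

/-- Differentiation under the integral sign for a jointly `C¹` integrand. -/
theorem hasFDerivAt_intervalIntegral_of_contDiff {E G : Type*} [NormedAddCommGroup E]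
    [NormedSpace ℝ E] [ProperSpace E] [NormedAddCommGroup G] [NormedSpace ℝ G]
    {f : E × ℝ → G} (hf : ContDiff ℝ 1 f) (a b : ℝ) (x₀ : E) :
    HasFDerivAt (fun x => ∫ s in a..b, f (x, s))
      (∫ s in a..b, (fderiv ℝ f (x₀, s)).comp (ContinuousLinearMap.inl ℝ E ℝ)) x₀ := by
  have hf' : Continuous fun p : E × ℝ => (fderiv ℝ f p).comp (ContinuousLinearMap.inl ℝ E ℝ) :=
    (hf.continuous_fderiv one_ne_zero).clm_comp continuous_const
  obtain ⟨C, hC⟩ := ((isCompact_closedBall x₀ 1).prod (isCompact_uIcc (a := a) (b := b)))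
    |>.exists_bound_of_continuousOn hf'.continuousOn
  refine intervalIntegral.hasFDerivAt_integral_of_dominated_of_fderiv_le
    (F' := fun x s => (fderiv ℝ f (x, s)).comp (ContinuousLinearMap.inl ℝ E ℝ))
    (bound := fun _ => C) (Metric.closedBall_mem_nhds x₀ one_pos)
    (.of_forall fun x => ?_) ?_ ?_ (.of_forall fun s hs x hx => ?_) (by simp)
    (.of_forall fun s _ x _ => ?_)
  · exact (hf.continuous.comp (Continuous.prodMk_right x)).aestronglyMeasurable
  · exact (hf.continuous.comp (Continuous.prodMk_right x₀)).intervalIntegrable a b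
  · exact (hf'.comp (Continuous.prodMk_right x₀)).aestronglyMeasurable
  · exact hC (x, s) ⟨hx, Set.uIoc_subset_uIcc hs⟩
  · exact ((hf.differentiable one_ne_zero).differentiableAt.hasFDerivAt (x := (x, s))).comp x
      (hasFDerivAt_prodMk_left x s)

theorem fderiv_intervalIntegral_apply {E G : Type*} [NormedAddCommGroup E]
    [NormedSpace ℝ E] [ProperSpace E] [NormedAddCommGroup G] [NormedSpace ℝ G]
    [CompleteSpace G] {f : E × ℝ → G} (hf : ContDiff ℝ 1 f) (a b : ℝ) (x v : E)
    {f' : ℝ → E →L[ℝ] G} (hf' : ∀ s, HasFDerivAt (fun x => f (x, s)) (f' s) x) :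
    fderiv ℝ (fun x => ∫ s in a..b, f (x, s)) x v = ∫ s in a..b, f' s v := by
  have hpartial (s : ℝ) :
      (fderiv ℝ f (x, s)).comp (ContinuousLinearMap.inl ℝ E ℝ) = f' s :=
    (((hf.differentiable one_ne_zero).differentiableAt.hasFDerivAt (x := (x, s))).comp x
      (hasFDerivAt_prodMk_left x s)).unique (hf' s)
  have hcont : Continuous f' := by
    simp_rw [← funext hpartial]
    exact ((hf.continuous_fderiv one_ne_zero).comp (Continuous.prodMk_right x)).clm_comp
      continuous_const
  rw [(hasFDerivAt_intervalIntegral_of_contDiff hf a b x).fderiv]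
  simp_rw [hpartial]
  exact ContinuousLinearMap.intervalIntegral_apply (hcont.intervalIntegrable a b) v

theorem ContDiff.intervalIntegral_of_prod {E G : Type*} [NormedAddCommGroup E]
    [NormedSpace ℝ E] [FiniteDimensional ℝ E] [NormedAddCommGroup G] [NormedSpace ℝ G]
    [CompleteSpace G] {f : E × ℝ → G} (hf : ContDiff ℝ ∞ f) (a b : ℝ) :
    ContDiff ℝ ∞ (fun x => ∫ s in a..b, f (x, s)) := by
  have : ProperSpace E := FiniteDimensional.proper ℝ E
  refine contDiff_infty.2 fun n => ?_
  induction n generalizing f with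
  | zero =>
    exact contDiff_zero.2 (continuous_iff_continuousAt.2 fun x =>
      (hasFDerivAt_intervalIntegral_of_contDiff (hf.of_le (by simp)) a b x).continuousAt)
  | succ n ih =>
    rw [Nat.cast_add, Nat.cast_one, contDiff_succ_iff_fderiv_apply]
    refine ⟨fun x =>
      (hasFDerivAt_intervalIntegral_of_contDiff (hf.of_le (by simp)) a b x).differentiableAt,
      by simp, fun v => ?_⟩
    have h (x : E) := fderiv_intervalIntegral_apply (hf.of_le (by simp)) a b x v fun s =>
      ((hf.differentiable (by simp)).differentiableAt.hasFDerivAt (x := (x, s))).comp x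
        (hasFDerivAt_prodMk_left x s)
    simp_rw [h]
    exact ih (f := fun p => fderiv ℝ f p (v, 0))
      ((hf.fderiv_right (m := ∞) (by simp)).clm_apply contDiff_const)

theorem ContinuousLinearMap.apply_eq_sum_single {ι : Type*} [Fintype ι] [DecidableEq ι]
    (L : (ι → ℝ) →L[ℝ] ℝ) (v : ι → ℝ) : L v = ∑ k, v k * L (Pi.single k 1) := by
  conv_lhs => rw [← Finset.univ_sum_single v, map_sum]
  refine Finset.sum_congr rfl fun k _ => ?_
  rw [← smul_eq_mul, ← map_smul, ← Pi.single_smul, smul_eq_mul, mul_one]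

/-- Derivative of `s ↦ s ^ n * f (y + s • v)`, with the chain rule written in coordinates. -/
theorem hasDerivAt_pow_mul_comp_line {ι : Type*} [Fintype ι] [DecidableEq ι]
    {f : (ι → ℝ) → ℝ} (hf : Differentiable ℝ f) (n : ℕ) (y v : ι → ℝ) (s : ℝ) :
    HasDerivAt (fun s : ℝ => s ^ n * f (y + s • v))
      (n * s ^ (n - 1) * f (y + s • v)
        + s ^ n * ∑ k, v k * fderiv ℝ f (y + s • v) (Pi.single k 1)) s := by
  rw [← ContinuousLinearMap.apply_eq_sum_single]
  have hline : HasDerivAt (fun s : ℝ => y + s • v) v s := by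
    simpa using ((hasDerivAt_id s).smul_const v).const_add y
  exact (hasDerivAt_pow n s).mul ((hf _).hasFDerivAt.comp_hasDerivAt s hline)

theorem hasFDerivAt_coord_mul_comp_line {ι : Type*} [Fintype ι]
    {f : (ι → ℝ) → ℝ} (hf : Differentiable ℝ f) (y x : ι → ℝ) (s : ℝ) (i : ι) :
    HasFDerivAt (fun x => (x i - y i) * f (y + s • (x - y)))
      ((x i - y i) • s • fderiv ℝ f (y + s • (x - y))
        + f (y + s • (x - y)) • ContinuousLinearMap.proj i) x := by
  have hline : HasFDerivAt (fun x => y + s • (x - y)) (s • ContinuousLinearMap.id ℝ (ι → ℝ)) x :=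
    (((hasFDerivAt_id x).sub_const y).const_smul s).const_add y
  have hcoord : HasFDerivAt (fun x : ι → ℝ => x i - y i) (ContinuousLinearMap.proj i) x :=
    (hasFDerivAt_apply (𝕜 := ℝ) (F' := fun _ => ℝ) i x).sub_const (y i)
  refine (hcoord.mul ((hf _).hasFDerivAt.comp x hline)).congr_fderiv ?_
  ext v
  simp

theorem magA_eq_integral {d : ℕ} {B : Fin d → Fin d → (Fin d → ℝ) → ℝ}
    (hB : ∀ j k, Continuous (B j k)) (y x : Fin d → ℝ) (k : Fin d) :
    magA d B y x k =
      ∫ s in (0 : ℝ)..1, ∑ j, s * ((x j - y j) * B j k (y + s • (x - y))) := by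
  rw [intervalIntegral.integral_finsetSum fun j _ =>
    Continuous.intervalIntegrable (by have := hB j k; fun_prop) _ _]
  simp only [magA, mul_assoc]

theorem contDiff_magA {d : ℕ} {B : Fin d → Fin d → (Fin d → ℝ) → ℝ}
    (hB : ∀ j k, ContDiff ℝ ∞ (B j k)) (y : Fin d → ℝ) (k : Fin d) :
    ContDiff ℝ ∞ (fun x => magA d B y x k) :=
  ContDiff.sum fun j _ => ContDiff.intervalIntegral_of_prod
    (f := fun p : (Fin d → ℝ) × ℝ => p.2 * (p.1 j - y j) * B j k (y + p.2 • (p.1 - y)))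
    (by have := hB j k; fun_prop) 0 1

theorem contDiff_magPhi {d : ℕ} {B : Fin d → Fin d → (Fin d → ℝ) → ℝ}
    (hB : ∀ j k, ContDiff ℝ ∞ (B j k)) :
    ContDiff ℝ ∞ (fun p : (Fin d → ℝ) × (Fin d → ℝ) => magPhi d B p.1 p.2) :=
  ContDiff.sum fun k _ => ContDiff.intervalIntegral_of_prod
    (f := fun q : ((Fin d → ℝ) × (Fin d → ℝ)) × ℝ =>
      magA d B 0 (q.1.2 + q.2 • (q.1.1 - q.1.2)) k * (q.1.1 k - q.1.2 k))
    (by have := contDiff_magA hB 0 k; fun_prop) 0 1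

theorem magPhi_eq_integral {d : ℕ} {B : Fin d → Fin d → (Fin d → ℝ) → ℝ}
    (hB : ∀ j k, ContDiff ℝ ∞ (B j k)) (x y : Fin d → ℝ) :
    magPhi d B x y =
      ∫ s in (0 : ℝ)..1, ∑ k, (x k - y k) * magA d B 0 (y + s • (x - y)) k := by
  rw [intervalIntegral.integral_finsetSum fun k _ =>
    Continuous.intervalIntegrable (by have := (contDiff_magA hB 0 k).continuous; fun_prop) _ _]
  simp only [magPhi, mul_comm]

theorem integral_pow_mul_comp_line {ι : Type*} [Fintype ι] [DecidableEq ι]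
    {f : (ι → ℝ) → ℝ} (hf : ContDiff ℝ 1 f) {n : ℕ} (hn : n ≠ 0) (y x : ι → ℝ) :
    ∫ s in (0 : ℝ)..1, (n * s ^ (n - 1) * f (y + s • (x - y))
      + s ^ n * ∑ k, (x - y) k * fderiv ℝ f (y + s • (x - y)) (Pi.single k 1)) = f x := by
  rw [intervalIntegral.integral_eq_sub_of_hasDerivAt fun s _ =>
    hasDerivAt_pow_mul_comp_line (hf.differentiable one_ne_zero) n y (x - y) s]
  · simp [hn]
  · have := hf.continuous
    have := hf.continuous_fderiv one_ne_zero
    exact Continuous.intervalIntegrable (by fun_prop) _ _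

/-- The transversal gauge potential is a primitive of the magnetic field. -/
theorem fderiv_magA_sub {d : ℕ} {B : Fin d → Fin d → (Fin d → ℝ) → ℝ}
    (hB : IsRegularMagneticField d B) (y x : Fin d → ℝ) (j k : Fin d) :
    fderiv ℝ (fun x => magA d B y x k) x (Pi.single j 1)
      - fderiv ℝ (fun x => magA d B y x j) x (Pi.single k 1) = B j k x := by
  have hdiff (i l : Fin d) : Differentiable ℝ (B i l) := (hB.smooth i l).differentiable (by simp)
  have hcont (i l : Fin d) : Continuous (B i l) := (hB.smooth i l).continuous
  have hcont' (i l : Fin d) : Continuous (fderiv ℝ (B i l)) :=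
    (hB.smooth i l).continuous_fderiv (by simp)
  have hpartial (l m : Fin d) :
      fderiv ℝ (fun x => magA d B y x l) x (Pi.single m 1) =
        ∫ s in (0 : ℝ)..1, (s * B m l (y + s • (x - y)) + s ^ 2 *
          ∑ i, (x - y) i * fderiv ℝ (B i l) (y + s • (x - y)) (Pi.single m 1)) := by
    simp_rw [magA_eq_integral hcont]
    rw [fderiv_intervalIntegral_apply
      (f := fun p : (Fin d → ℝ) × ℝ => ∑ i, p.2 * ((p.1 i - y i) * B i l (y + p.2 • (p.1 - y))))
      (by have := fun i => (hB.smooth i l).of_le (m := 1) (by simp); fun_prop) 0 1 x _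
      fun s => HasFDerivAt.fun_sum fun i _ =>
        (hasFDerivAt_coord_mul_comp_line (hdiff i l) y x s i).const_mul s]
    congr! 2 with s
    simp [Finset.sum_add_distrib, Finset.mul_sum, Pi.single_apply, add_comm]
    refine Finset.sum_congr rfl fun i _ => ?_
    ring
  rw [hpartial, hpartial, ← intervalIntegral.integral_sub
    (Continuous.intervalIntegrable (by fun_prop) _ _)
    (Continuous.intervalIntegrable (by fun_prop) _ _),
    ← integral_pow_mul_comp_line ((hB.smooth j k).of_le (by simp)) two_ne_zero y x]
  congr! 2 with s
  have hclosed : ∑ i, (x - y) i * fderiv ℝ (B j k) (y + s • (x - y)) (Pi.single i 1) =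
      ∑ i, (x - y) i * fderiv ℝ (B i k) (y + s • (x - y)) (Pi.single j 1)
        - ∑ i, (x - y) i * fderiv ℝ (B i j) (y + s • (x - y)) (Pi.single k 1) := by
    rw [← Finset.sum_sub_distrib]
    refine Finset.sum_congr rfl fun i _ => ?_
    have hki : fderiv ℝ (B k i) (y + s • (x - y)) = - fderiv ℝ (B i k) (y + s • (x - y)) := by
      rw [← fderiv_fun_neg]
      congr 1
      exact funext (hB.antisymm k i)
    have := hB.closed i j k (y + s • (x - y))
    rw [hki, neg_apply] at this
    linear_combination (x - y) i * this
  rw [hclosed, hB.antisymm k j]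
  push_cast
  ring

/-- The Stokes theorem on the triangle with vertices `0`, `y`, `x`, differentiated in `x`. -/
theorem fderiv_magPhi {d : ℕ} {B : Fin d → Fin d → (Fin d → ℝ) → ℝ}
    (hB : IsRegularMagneticField d B) (j : Fin d) (x y : Fin d → ℝ) :
    fderiv ℝ (fun x => magPhi d B x y) x (Pi.single j 1)
      = magA d B 0 x j - magA d B y x j := by
  have hA (k : Fin d) : ContDiff ℝ 1 (fun x => magA d B 0 x k) :=
    (contDiff_magA hB.smooth 0 k).of_le (by simp)
  have hcont (i l : Fin d) : Continuous (B i l) := (hB.smooth i l).continuous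
  have hAcont (k : Fin d) := (hA k).continuous
  have hAcont' (k : Fin d) := (hA k).continuous_fderiv one_ne_zero
  simp_rw [magPhi_eq_integral hB.smooth]
  rw [fderiv_intervalIntegral_apply
      (f := fun p : (Fin d → ℝ) × ℝ => ∑ k, (p.1 k - y k) * magA d B 0 (y + p.2 • (p.1 - y)) k)
      (by fun_prop) 0 1 x _
      fun s => HasFDerivAt.fun_sum fun k _ =>
        hasFDerivAt_coord_mul_comp_line ((hA k).differentiable one_ne_zero) y x s k,
    ← integral_pow_mul_comp_line (hA j) one_ne_zero y x, magA_eq_integral hcont,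
    ← intervalIntegral.integral_sub
      (Continuous.intervalIntegrable (by fun_prop) _ _)
      (Continuous.intervalIntegrable (by fun_prop) _ _)]
  congr! 2 with s
  have hsum : ∑ k, (x k - y k) *
        fderiv ℝ (fun x => magA d B 0 x k) (y + s • (x - y)) (Pi.single j 1) =
      ∑ k, (x k - y k) * fderiv ℝ (fun x => magA d B 0 x j) (y + s • (x - y)) (Pi.single k 1)
        - ∑ k, (x k - y k) * B k j (y + s • (x - y)) := by
    rw [← Finset.sum_sub_distrib]
    refine Finset.sum_congr rfl fun k _ => ?_
    have := fderiv_magA_sub hB 0 (y + s • (x - y)) j k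
    rw [hB.antisymm j k] at this
    linear_combination (x k - y k) * this
  have := congrArg (s * ·) hsum
  simp only [mul_sub, Finset.mul_sum, mul_left_comm s] at this
  simp [Finset.sum_add_distrib, Pi.single_apply, Finset.mul_sum, mul_left_comm s, this]
  ring

/-- the circulation `φ` is smooth on `ℝ^d × ℝ^d` and
`∂_{x_j} φ(x,y) − A_j(x) = −A_j(x;y)`. -/
theorem statement1 (d : ℕ) (hd : 0 < d) (B : Fin d → Fin d → (Fin d → ℝ) → ℝ)
    (hB : IsRegularMagneticField d B) :
    ContDiff ℝ (⊤ : ℕ∞) (fun p : (Fin d → ℝ) × (Fin d → ℝ) => magPhi d B p.1 p.2) ∧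
    ∀ (j : Fin d) (x y : Fin d → ℝ),
      fderiv ℝ (fun x => magPhi d B x y) x (Pi.single j 1) - magA d B 0 x j
        = - magA d B y x j := by
  exact ⟨contDiff_magPhi hB.smooth, fun j x y => by rw [fderiv_magPhi hB]; ring⟩
end
end

section
/- Let B be a regular magnetic field on ℝ^d. Then the transversal-gauge potentials based at y grow at most linearly in |x − y| together with all their derivatives, uniformly in the base point: for every m ∈ ℕ there exists a constant C > 0 such that for every y ∈ ℝ^d, every x ∈ ℝ^d, every k ∈ {1,…,d}, and every multi-index γ with |γ| = m, one has |∂_x^γ A_k(x;y)| ≤ C·(1 + ‖x − y‖). -/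
open MeasureTheory Filter
open scoped ENNReal

noncomputable section

section SegmentIntegral

variable {E F : Type*} [NormedAddCommGroup E] [NormedSpace ℝ E]
  [NormedAddCommGroup F] [NormedSpace ℝ F]

/-- The weighted average `∫₀¹ sᵖ f(y + s(x - y)) ds` of `f` along the segment from `y` to `x`. -/
def segmentIntegral (p : ℕ) (f : E → F) (y x : E) : F :=
  ∫ s in (0 : ℝ)..1, s ^ p • f (y + s • (x - y))

lemma norm_pow_smul_le {p : ℕ} {s C : ℝ} (hs : s ∈ Set.uIoc (0 : ℝ) 1) {v : F} (hv : ‖v‖ ≤ C) :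
    ‖s ^ p • v‖ ≤ C := by
  rw [Set.uIoc_of_le zero_le_one] at hs
  rw [norm_smul, norm_pow, Real.norm_of_nonneg hs.1.le]
  exact (mul_le_of_le_one_left (norm_nonneg v) (pow_le_one₀ hs.1.le hs.2)).trans hv

lemma norm_segmentIntegral_le (p : ℕ) {f : E → F} {C : ℝ} (hC : ∀ x, ‖f x‖ ≤ C) (y x : E) :
    ‖segmentIntegral p f y x‖ ≤ C := by
  simpa [segmentIntegral] using intervalIntegral.norm_integral_le_of_norm_le_const
    (f := fun s : ℝ => s ^ p • f (y + s • (x - y))) (a := 0) (b := 1)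
    fun s hs => norm_pow_smul_le hs (hC _)

lemma hasFDerivAt_segmentIntegral (p : ℕ) {f : E → F} (hf : ContDiff ℝ 1 f) {C : ℝ}
    (hC : ∀ x, ‖fderiv ℝ f x‖ ≤ C) (y x : E) :
    HasFDerivAt (segmentIntegral p f y) (segmentIntegral (p + 1) (fderiv ℝ f) y x) x := by
  have hcont : Continuous f := hf.continuous
  have hcont' : Continuous (fderiv ℝ f) := hf.continuous_fderiv one_ne_zero
  have hint : ∀ z : E, Continuous fun s : ℝ => s ^ p • f (y + s • (z - y)) := fun z => by fun_prop
  refine intervalIntegral.hasFDerivAt_integral_of_dominated_of_fderiv_le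
    (F' := fun z s => s ^ (p + 1) • fderiv ℝ f (y + s • (z - y))) (bound := fun _ => C)
    Filter.univ_mem (.of_forall fun z => (hint z).aestronglyMeasurable)
    ((hint x).intervalIntegrable _ _) ?_
    (.of_forall fun s hs z _ => norm_pow_smul_le hs (hC _)) intervalIntegrable_const
    (.of_forall fun s _ z _ => ?_)
  · exact Continuous.aestronglyMeasurable (by fun_prop)
  · have hseg : HasFDerivAt (fun z : E => y + s • (z - y)) (s • ContinuousLinearMap.id ℝ E) z :=
      (((hasFDerivAt_id z).sub_const y).const_smul s).const_add y
    refine (((hf.differentiable one_ne_zero _).hasFDerivAt.comp z hseg).const_smul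
      (s ^ p)).congr_fderiv ?_
    ext w
    simp [pow_succ, mul_smul]

end SegmentIntegral

section SmoothBounded

variable {E F : Type} [NormedAddCommGroup E] [NormedSpace ℝ E]
  [NormedAddCommGroup F] [NormedSpace ℝ F]

lemma fderiv_segmentIntegral (p : ℕ) {f : E → F} (hf : ContDiff ℝ 1 f) {C : ℝ}
    (hC : ∀ x, ‖fderiv ℝ f x‖ ≤ C) (y : E) :
    fderiv ℝ (segmentIntegral p f y) = segmentIntegral (p + 1) (fderiv ℝ f) y :=
  funext fun x => (hasFDerivAt_segmentIntegral p hf hC y x).fderiv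

/-- Bounds on the derivatives of `f` pass to its segment averages, uniformly in the base point. -/
lemma contDiff_segmentIntegral_and_norm_iteratedFDeriv_le (n p : ℕ) {f : E → F}
    (hf : ContDiff ℝ (⊤ : ℕ∞) f) {C : ℕ → ℝ} (hC : ∀ i x, ‖iteratedFDeriv ℝ i f x‖ ≤ C i)
    (y : E) :
    ContDiff ℝ n (segmentIntegral p f y) ∧
      ∀ x, ‖iteratedFDeriv ℝ n (segmentIntegral p f y) x‖ ≤ C n := by
  have hf1 : ContDiff ℝ 1 f := hf.of_le (by exact_mod_cast le_top)
  have hC1 : ∀ x, ‖fderiv ℝ f x‖ ≤ C 1 := fun x => by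
    simpa only [norm_iteratedFDeriv_one] using hC 1 x
  induction n generalizing F p C with
  | zero =>
    refine ⟨?_, fun x => ?_⟩
    · rw [Nat.cast_zero, contDiff_zero]
      exact continuous_iff_continuousAt.2 fun x =>
        (hasFDerivAt_segmentIntegral p hf1 hC1 y x).continuousAt
    · rw [norm_iteratedFDeriv_zero]
      exact norm_segmentIntegral_le p (fun x => by simpa using hC 0 x) y x
  | succ n ih =>
    have hf' : ContDiff ℝ (⊤ : ℕ∞) (fderiv ℝ f) := (contDiff_infty_iff_fderiv.1 hf).2
    have hC' : ∀ i x, ‖iteratedFDeriv ℝ i (fderiv ℝ f) x‖ ≤ C (i + 1) := fun i x => by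
      simpa only [norm_iteratedFDeriv_fderiv] using hC (i + 1) x
    obtain ⟨hsmooth, hbound⟩ := ih (p + 1) hf' hC' (hf'.of_le (by exact_mod_cast le_top))
      fun x => by simpa only [norm_iteratedFDeriv_one] using hC' 1 x
    rw [← fderiv_segmentIntegral p hf1 hC1] at hsmooth hbound
    refine ⟨?_, fun x => ?_⟩
    · rw [Nat.cast_succ, contDiff_succ_iff_fderiv]
      exact ⟨fun x => (hasFDerivAt_segmentIntegral p hf1 hC1 y x).differentiableAt,
        by simp, hsmooth⟩
    · rw [← norm_iteratedFDeriv_fderiv]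
      exact hbound x

end SmoothBounded

lemma norm_iteratedFDeriv_coord_sub_le {d : ℕ} (i : ℕ) (j : Fin d) (y x : Fin d → ℝ) :
    ‖iteratedFDeriv ℝ i (fun x : Fin d → ℝ => x j - y j) x‖ ≤ 1 + ‖x - y‖ := by
  cases i with
  | zero =>
    rw [norm_iteratedFDeriv_zero]
    exact (norm_le_pi_norm (x - y) j).trans (le_add_of_nonneg_left zero_le_one)
  | succ i =>
    have hfderiv : fderiv ℝ (fun x : Fin d → ℝ => x j - y j) =
        fun _ => ContinuousLinearMap.proj (R := ℝ) (φ := fun _ : Fin d => ℝ) j :=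
      funext fun z => ((hasFDerivAt_apply j z).sub_const (y j)).fderiv
    rw [← norm_iteratedFDeriv_fderiv, hfderiv]
    cases i with
    | zero =>
      rw [norm_iteratedFDeriv_zero]
      refine ContinuousLinearMap.opNorm_le_bound _ (by positivity) fun v => ?_
      calc ‖v j‖ ≤ ‖v‖ := norm_le_pi_norm v j
        _ ≤ (1 + ‖x - y‖) * ‖v‖ :=
          le_mul_of_one_le_left (norm_nonneg v) (le_add_of_nonneg_right (norm_nonneg _))
    | succ i =>
      rw [iteratedFDeriv_const_of_ne i.succ_ne_zero]
      simpa using add_nonneg zero_le_one (norm_nonneg (x - y))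

lemma magA_eq_sum_segmentIntegral (d : ℕ) (B : Fin d → Fin d → (Fin d → ℝ) → ℝ)
    (y x : Fin d → ℝ) (k : Fin d) :
    magA d B y x k = ∑ j, (x j - y j) * segmentIntegral 1 (B j k) y x := by
  refine Finset.sum_congr rfl fun j _ => ?_
  rw [segmentIntegral, ← intervalIntegral.integral_const_mul]
  refine intervalIntegral.integral_congr fun s _ => ?_
  simp only [pow_one, smul_eq_mul]
  ring

/-- the transversal-gauge potentials based at `y` grow at most linearly in
`‖x−y‖` together with all their derivatives, uniformly in the base point `y`. -/
theorem statement2 (d : ℕ) (hd : 0 < d) (B : Fin d → Fin d → (Fin d → ℝ) → ℝ)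
    (hB : IsRegularMagneticField d B) (m : ℕ) :
    ∃ C > 0, ∀ (y x : Fin d → ℝ) (k : Fin d) (v : Fin m → Fin d),
      |iteratedFDeriv ℝ m (fun x => magA d B y x k) x (fun i => Pi.single (v i) (1 : ℝ))|
        ≤ C * (1 + ‖x - y‖) := by
  choose K hK using hB.derivBounded
  have hK0 : ∀ j k n, 0 ≤ K j k n := fun j k n => (norm_nonneg _).trans (hK j k n 0)
  let S : Fin d → Fin d → ℝ := fun k j =>
    ∑ i ∈ Finset.range (m + 1), (m.choose i : ℝ) * K j k (m - i)
  have hS0 : ∀ k j, 0 ≤ S k j := fun k j =>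
    Finset.sum_nonneg fun i _ => mul_nonneg (Nat.cast_nonneg _) (hK0 _ _ _)
  have hSk0 : ∀ k, 0 ≤ ∑ j, S k j := fun k => Finset.sum_nonneg fun j _ => hS0 k j
  refine ⟨1 + ∑ k, ∑ j, S k j,
    add_pos_of_pos_of_nonneg one_pos (Finset.sum_nonneg fun k _ => hSk0 k), fun y x k v => ?_⟩
  have hcoord : ∀ j, ContDiff ℝ m fun x : Fin d → ℝ => x j - y j := fun j => by fun_prop
  have hseg := fun n j =>
    contDiff_segmentIntegral_and_norm_iteratedFDeriv_le n 1 (hB.smooth j k) (hK j k) y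
  have hterm : ∀ j, ‖iteratedFDeriv ℝ m
      (fun x => (x j - y j) * segmentIntegral 1 (B j k) y x) x‖ ≤ S k j * (1 + ‖x - y‖) := by
    intro j
    refine (norm_iteratedFDeriv_mul_le (hcoord j) (hseg m j).1 x le_rfl).trans ?_
    rw [Finset.sum_mul]
    refine Finset.sum_le_sum fun i _ => ?_
    rw [mul_right_comm]
    have h1 := norm_iteratedFDeriv_coord_sub_le i j y x
    have h2 := (hseg (m - i) j).2 x
    have h3 := hK0 j k (m - i)
    gcongr
  simp only [magA_eq_sum_segmentIntegral]
  rw [iteratedFDeriv_sum fun j _ => (hcoord j).mul (hseg m j).1, Finset.sum_apply,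
    ← Real.norm_eq_abs]
  calc _ ≤ ‖∑ j, iteratedFDeriv ℝ m
          (fun x => (x j - y j) * segmentIntegral 1 (B j k) y x) x‖ := by
        refine (ContinuousMultilinearMap.le_opNorm_mul_prod_of_le _ (b := fun _ => 1)
          fun i => ?_).trans_eq (by simp)
        simp [Pi.norm_single]
    _ ≤ ∑ j, S k j * (1 + ‖x - y‖) := norm_sum_le_of_le _ fun j _ => hterm j
    _ = (∑ j, S k j) * (1 + ‖x - y‖) := (Finset.sum_mul ..).symm
    _ ≤ _ := by
        gcongr
        linarith [Finset.single_le_sum (fun k _ => hSk0 k) (Finset.mem_univ k)]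
end
end

section
/- For every tempered weight m on ℝ^N there exist an infinitely differentiable function m̃ : ℝ^N → ℝ which is itself a tempered weight, and a constant C ≥ 1, such that C⁻¹·m(x) ≤ m̃(x) ≤ C·m(x) for all x ∈ ℝ^N. -/
open MeasureTheory Filter
open scoped ENNReal

noncomputable section

lemma continuous_jbV {N : ℕ} : Continuous (jbV : (Fin N → ℝ) → ℝ) := by
  unfold jbV
  fun_prop

lemma one_le_jbV {N : ℕ} (v : Fin N → ℝ) : 1 ≤ jbV v :=
  Real.one_le_sqrt.mpr (le_add_of_nonneg_right (Finset.sum_nonneg fun i _ => sq_nonneg (v i)))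

lemma jbV_zero {N : ℕ} : jbV (0 : Fin N → ℝ) = 1 := by
  simp [jbV]

/-- A positive function squeezed between multiples of a tempered weight is a tempered weight. -/
lemma IsTemperedWeight.of_equivalent {N : ℕ} {m mt : (Fin N → ℝ) → ℝ} (hm : IsTemperedWeight m)
    {K : ℝ} (hK : 0 < K) (h : ∀ x, K⁻¹ * m x ≤ mt x ∧ mt x ≤ K * m x) : IsTemperedWeight mt := by
  obtain ⟨hpos, C, hC, a, ha, hle⟩ := hm
  refine ⟨fun u => lt_of_lt_of_le (mul_pos (inv_pos.mpr hK) (hpos u)) (h u).1,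
    K * C * K, by positivity, a, ha, fun u v => ?_⟩
  have hj : 0 < jbV v ^ a := Real.rpow_pos_of_pos (zero_lt_one.trans_le (one_le_jbV v)) a
  have hmu : m u ≤ K * mt u := (inv_mul_le_iff₀ hK).mp (h u).1
  calc mt (u + v) ≤ K * m (u + v) := (h _).2
    _ ≤ K * (C * m u * jbV v ^ a) := by gcongr; exact hle u v
    _ ≤ K * (C * (K * mt u) * jbV v ^ a) := by gcongr
    _ = K * C * K * mt u * jbV v ^ a := by ring

/-- A tempered weight is comparable, near each point, to its value at that point, with a
constant independent of the point. -/
lemma IsTemperedWeight.exists_eventually_comparable {N : ℕ} {m : (Fin N → ℝ) → ℝ}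
    (hm : IsTemperedWeight m) :
    ∃ K : ℝ, 1 ≤ K ∧ ∀ x, ∀ᶠ y in nhds x, m x ∈ Set.Icc (K⁻¹ * m y) (K * m y) := by
  obtain ⟨hpos, C, hC, a, ha, hle⟩ := hm
  have hK : 0 < max 1 (C * 2 ^ a) := lt_max_of_lt_left one_pos
  have bound : ∀ u v : Fin N → ℝ, jbV (v - u) < 2 → m v ≤ max 1 (C * 2 ^ a) * m u := by
    intro u v huv
    have hj : jbV (v - u) ^ a ≤ 2 ^ a :=
      Real.rpow_le_rpow (zero_le_one.trans (one_le_jbV _)) huv.le ha.le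
    have hu := hpos u
    calc m v = m (u + (v - u)) := by rw [add_sub_cancel]
      _ ≤ C * m u * jbV (v - u) ^ a := hle _ _
      _ ≤ C * m u * 2 ^ a := by gcongr
      _ = C * 2 ^ a * m u := by ring
      _ ≤ max 1 (C * 2 ^ a) * m u := by gcongr; exact le_max_right _ _
  have near : ∀ x : Fin N → ℝ, ∀ f : (Fin N → ℝ) → (Fin N → ℝ), Continuous f → f x = 0 →
      ∀ᶠ y in nhds x, jbV (f y) < 2 := fun x f hf hx =>
    (continuous_jbV.comp hf).continuousAt.eventually_lt continuousAt_const
      (by simp [hx, jbV_zero])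
  refine ⟨max 1 (C * 2 ^ a), le_max_left _ _, fun x => ?_⟩
  filter_upwards [near x (fun y => y - x) (by fun_prop) (sub_self x),
    near x (fun y => x - y) (by fun_prop) (sub_self x)] with y h₁ h₂
  exact ⟨(inv_mul_le_iff₀ hK).mpr (bound x y h₁), bound y x h₂⟩

/-- every tempered weight is equivalent to a smooth tempered weight. -/
theorem statement3 (N : ℕ) (hN : 0 < N) (m : (Fin N → ℝ) → ℝ) (hm : IsTemperedWeight m) :
    ∃ (mt : (Fin N → ℝ) → ℝ) (C : ℝ), 1 ≤ C ∧ ContDiff ℝ (⊤ : ℕ∞) mt ∧ IsTemperedWeight mt ∧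
      ∀ x, C⁻¹ * m x ≤ mt x ∧ mt x ≤ C * m x := by
  obtain ⟨K, hK, hloc⟩ := hm.exists_eventually_comparable
  obtain ⟨g, hg⟩ := exists_contMDiffMap_forall_mem_convex_of_local_const
    (modelWithCornersSelf ℝ (Fin N → ℝ)) (n := ⊤)
    (t := fun y => Set.Icc (K⁻¹ * m y) (K * m y)) (fun _ => convex_Icc _ _)
    (fun x => ⟨m x, hloc x⟩)
  exact ⟨g, K, hK, g.contMDiff.contDiff, hm.of_equivalent (one_pos.trans_le hK) hg, hg⟩
end
end

section
/- For every Schwartz function F ∈ 𝒮(ℝ^{2d};ℂ) and every n ∈ ℕ, the frame coefficients decay super-polynomially: sup_{α̃,β̃∈ℤ^d×ℤ^d} ⟨(α̃,β̃)⟩^n · |c_{α̃,β̃}(F)| < ∞, where (α̃,β̃) is regarded as a point of ℝ^{4d}. -/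
open MeasureTheory Filter
open scoped ENNReal

noncomputable section

theorem Function.HasTemperateGrowth.fderiv {E F : Type*} [NormedAddCommGroup E] [NormedSpace ℝ E]
    [NormedAddCommGroup F] [NormedSpace ℝ F] {f : E → F} (hf : f.HasTemperateGrowth) :
    (fderiv ℝ f).HasTemperateGrowth := by
  refine ⟨hf.1.fderiv_right (by simp), fun n => ?_⟩
  obtain ⟨k, C, h⟩ := hf.2 (n + 1)
  refine ⟨k, C, fun x => ?_⟩
  have := h x
  rwa [iteratedFDeriv_succ_eq_comp_right, Function.comp_apply, LinearIsometryEquiv.norm_map]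
    at this

section ParametricIntegral

variable {E F : Type*} [NormedAddCommGroup E] [NormedSpace ℝ E]
  [NormedAddCommGroup F] [NormedSpace ℝ F]

theorem Function.HasTemperateGrowth.norm_le_of_mem_Ioc {h : ℝ × E → F}
    (hh : h.HasTemperateGrowth) :
    ∃ (k : ℕ) (C : ℝ), 0 ≤ C ∧
      ∀ x, ∀ s ∈ Set.uIoc (0 : ℝ) 1, ‖h (s, x)‖ ≤ C * (1 + ‖x‖) ^ k := by
  obtain ⟨k, C, hC, h0⟩ := hh.norm_iteratedFDeriv_le_uniform 0
  refine ⟨k, C * 2 ^ k, by positivity, fun x s hs => ?_⟩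
  have h1 : ‖h (s, x)‖ ≤ C * (1 + ‖(s, x)‖) ^ k := by simpa using h0 0 le_rfl (s, x)
  refine h1.trans ?_
  rw [mul_assoc, ← mul_pow]
  rw [Set.uIoc_of_le zero_le_one] at hs
  have h2 : ‖(s, x)‖ ≤ 1 + ‖x‖ := by
    rw [Prod.norm_mk]
    refine max_le ?_ (by linarith)
    rw [Real.norm_eq_abs, abs_of_pos hs.1]
    linarith [hs.2, norm_nonneg x]
  gcongr
  linarith [norm_nonneg x]

theorem Function.HasTemperateGrowth.fderiv_prodMk_right {h : ℝ × E → F}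
    (hh : h.HasTemperateGrowth) :
    (fun p : ℝ × E => (_root_.fderiv ℝ h p).comp
      (ContinuousLinearMap.inr ℝ ℝ E)).HasTemperateGrowth :=
  ((ContinuousLinearMap.compL ℝ E (ℝ × E) F).flip
    (ContinuousLinearMap.inr ℝ ℝ E)).hasTemperateGrowth.comp hh.fderiv

theorem Function.HasTemperateGrowth.hasFDerivAt_intervalIntegral [CompleteSpace F]
    {h : ℝ × E → F} (hh : h.HasTemperateGrowth) (x : E) :
    HasFDerivAt (fun x => ∫ s in (0 : ℝ)..1, h (s, x))
      (∫ s in (0 : ℝ)..1, (_root_.fderiv ℝ h (s, x)).comp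
        (ContinuousLinearMap.inr ℝ ℝ E)) x := by
  obtain ⟨k, C, hC, hb⟩ := hh.fderiv_prodMk_right.norm_le_of_mem_Ioc
  have hcont (y : E) : Continuous fun s : ℝ => h (s, y) :=
    hh.1.continuous.comp (by fun_prop)
  have hcont' : Continuous fun s : ℝ => (_root_.fderiv ℝ h (s, x)).comp
      (ContinuousLinearMap.inr ℝ ℝ E) :=
    hh.fderiv_prodMk_right.1.continuous.comp (by fun_prop : Continuous fun s : ℝ => (s, x))
  refine (intervalIntegral.hasFDerivAt_integral_of_dominated_of_fderiv_le
    (s := Metric.ball x 1) (bound := fun _ => C * (1 + (‖x‖ + 1)) ^ k)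
    (F' := fun y s => (_root_.fderiv ℝ h (s, y)).comp (ContinuousLinearMap.inr ℝ ℝ E))
    (Metric.ball_mem_nhds x one_pos) (.of_forall fun y => (hcont y).aestronglyMeasurable)
    ((hcont x).intervalIntegrable _ _) hcont'.aestronglyMeasurable
    (.of_forall fun s hs y hy => ?_) (by simp) (.of_forall fun s hs y hy => ?_))
  · refine (hb y s hs).trans ?_
    have : ‖y‖ ≤ ‖x‖ + 1 := by
      have := norm_le_norm_add_norm_sub' y x
      rw [Metric.mem_ball, dist_eq_norm] at hy
      linarith
    gcongr
  · exact ((hh.1.differentiable (by simp)) (s, y)).hasFDerivAt.comp y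
      (hasFDerivAt_prodMk_right s y)

end ParametricIntegral

universe u in
theorem Function.HasTemperateGrowth.intervalIntegral {E F : Type u} [NormedAddCommGroup E]
    [NormedSpace ℝ E] [NormedAddCommGroup F] [NormedSpace ℝ F] [CompleteSpace F]
    {h : ℝ × E → F} (hh : h.HasTemperateGrowth) :
    (fun x => ∫ s in (0 : ℝ)..1, h (s, x)).HasTemperateGrowth := by
  suffices H : ∀ n : ℕ, ContDiff ℝ n (fun x => ∫ s in (0 : ℝ)..1, h (s, x)) ∧
      ∃ (k : ℕ) (C : ℝ), ∀ x, ‖iteratedFDeriv ℝ n (fun x => ∫ s in (0 : ℝ)..1, h (s, x)) x‖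
        ≤ C * (1 + ‖x‖) ^ k from
    ⟨contDiff_infty.2 fun n => (H n).1, fun n => (H n).2⟩
  intro n
  induction n generalizing F with
  | zero =>
    obtain ⟨k, C, -, hb⟩ := hh.norm_le_of_mem_Ioc
    refine ⟨contDiff_zero.2 (continuous_iff_continuousAt.2 fun x =>
      (hh.hasFDerivAt_intervalIntegral x).continuousAt), k, C, fun x => ?_⟩
    rw [norm_iteratedFDeriv_zero]
    simpa using intervalIntegral.norm_integral_le_of_norm_le_const (hb x)
  | succ n ih =>
    have hfd : _root_.fderiv ℝ (fun x => ∫ s in (0 : ℝ)..1, h (s, x)) = fun x =>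
        ∫ s in (0 : ℝ)..1, (_root_.fderiv ℝ h (s, x)).comp (ContinuousLinearMap.inr ℝ ℝ E) :=
      funext fun x => (hh.hasFDerivAt_intervalIntegral x).fderiv
    obtain ⟨h1, k, C, h2⟩ := ih hh.fderiv_prodMk_right
    rw [← hfd] at h1
    refine ⟨?_, k, C, fun x => ?_⟩
    · push_cast
      exact contDiff_succ_iff_fderiv.2 ⟨fun x =>
        (hh.hasFDerivAt_intervalIntegral x).differentiableAt, by simp, h1⟩
    · simp only [iteratedFDeriv_succ_eq_comp_right, Function.comp_apply, hfd,
        LinearIsometryEquiv.norm_map]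
      exact h2 x

theorem Complex.hasTemperateGrowth_exp_I_mul_ofReal :
    (fun t : ℝ => Complex.exp (Complex.I * t)).HasTemperateGrowth := by
  have hd : ∀ t : ℝ, HasDerivAt (fun t : ℝ => Complex.exp (Complex.I * t))
      (Complex.I * Complex.exp (Complex.I * t)) t := fun t => by
    simpa [mul_comm] using ((Complex.ofRealCLM.hasDerivAt (x := t)).const_mul Complex.I).cexp
  have hi : ∀ n : ℕ, iteratedDeriv n (fun t : ℝ => Complex.exp (Complex.I * t)) =
      fun t : ℝ => Complex.I ^ n * Complex.exp (Complex.I * t) := fun n => by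
    induction n with
    | zero => simp
    | succ n ih =>
      rw [iteratedDeriv_succ, ih]
      ext t
      rw [((hd t).const_mul _).deriv]
      ring
  refine ⟨?_, fun n => ⟨0, 1, fun t => ?_⟩⟩
  · exact (contDiff_const.mul Complex.ofRealCLM.contDiff).cexp
  · rw [norm_iteratedFDeriv_eq_norm_iteratedDeriv, hi]
    simp [mul_comm Complex.I, Complex.norm_exp_ofReal_mul_I]

theorem IsRegularMagneticField.hasTemperateGrowth {d : ℕ} {B : Fin d → Fin d → (Fin d → ℝ) → ℝ}
    (hB : IsRegularMagneticField d B) (j k : Fin d) : (B j k).HasTemperateGrowth := by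
  refine ⟨hB.smooth j k, fun n => ?_⟩
  obtain ⟨C, hC⟩ := hB.derivBounded j k n
  exact ⟨0, C, by simpa using hC⟩

theorem Function.HasTemperateGrowth.pi_apply {E : Type*} [NormedAddCommGroup E] [NormedSpace ℝ E]
    {d : ℕ} {f : E → Fin d → ℝ} (hf : f.HasTemperateGrowth) (i : Fin d) :
    (fun x => f x i).HasTemperateGrowth :=
  (ContinuousLinearMap.proj (R := ℝ) (φ := fun _ : Fin d => ℝ) i).hasTemperateGrowth.comp hf

theorem Function.HasTemperateGrowth.fst {E F : Type*} [NormedAddCommGroup E] [NormedSpace ℝ E]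
    [NormedAddCommGroup F] [NormedSpace ℝ F] :
    (Prod.fst : E × F → E).HasTemperateGrowth :=
  (ContinuousLinearMap.fst ℝ E F).hasTemperateGrowth

theorem Function.HasTemperateGrowth.snd {E F : Type*} [NormedAddCommGroup E] [NormedSpace ℝ E]
    [NormedAddCommGroup F] [NormedSpace ℝ F] :
    (Prod.snd : E × F → F).HasTemperateGrowth :=
  (ContinuousLinearMap.snd ℝ E F).hasTemperateGrowth

theorem hasTemperateGrowth_magA {d : ℕ} {B : Fin d → Fin d → (Fin d → ℝ) → ℝ}
    (hB : IsRegularMagneticField d B) (k : Fin d) :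
    (fun x => magA d B 0 x k).HasTemperateGrowth := by
  refine Function.HasTemperateGrowth.sum fun j _ => ?_
  refine Function.HasTemperateGrowth.intervalIntegral
    (h := fun p : ℝ × (Fin d → ℝ) =>
      p.1 * (p.2 j - (0 : Fin d → ℝ) j) * B j k (0 + p.1 • (p.2 - 0))) ?_
  simp only [Pi.zero_apply, sub_zero, zero_add]
  exact (Function.HasTemperateGrowth.fst.mul (Function.HasTemperateGrowth.snd.pi_apply j)).mul
    ((hB.hasTemperateGrowth j k).comp
      (Function.HasTemperateGrowth.fst.smul Function.HasTemperateGrowth.snd))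

theorem hasTemperateGrowth_magPhi {d : ℕ} {B : Fin d → Fin d → (Fin d → ℝ) → ℝ}
    (hB : IsRegularMagneticField d B) :
    (fun p : E1 d × E1 d => magPhi d B p.1 p.2).HasTemperateGrowth := by
  refine Function.HasTemperateGrowth.sum fun k _ => ?_
  refine Function.HasTemperateGrowth.intervalIntegral
    (h := fun p : ℝ × (E1 d × E1 d) =>
      magA d B 0 (p.2.2 + p.1 • (p.2.1 - p.2.2)) k * (p.2.1 k - p.2.2 k)) ?_
  have h1 : (fun p : ℝ × (E1 d × E1 d) => p.2.1).HasTemperateGrowth :=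
    Function.HasTemperateGrowth.fst.comp Function.HasTemperateGrowth.snd
  have h2 : (fun p : ℝ × (E1 d × E1 d) => p.2.2).HasTemperateGrowth :=
    Function.HasTemperateGrowth.snd.comp Function.HasTemperateGrowth.snd
  exact ((hasTemperateGrowth_magA hB k).comp
    (h2.add (Function.HasTemperateGrowth.fst.smul (h1.sub h2)))).mul
    ((h1.pi_apply k).sub (h2.pi_apply k))

section OscillatoryIntegral

variable {V W : Type*} [NormedAddCommGroup V] [NormedSpace ℝ V]
  [NormedAddCommGroup W] [NormedSpace ℝ W]

theorem SchwartzMap.exists_norm_pow_mul_one_add_norm_pow_le (S : SchwartzMap (V × W) ℂ)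
    (k N : ℕ) : ∃ C : ℝ, ∀ u z, ‖u‖ ^ k * ((1 + ‖z‖) ^ N * ‖S (u, z)‖) ≤ C := by
  refine ⟨_, fun u z => le_trans ?_ (SchwartzMap.one_add_le_sup_seminorm_apply (𝕜 := ℝ)
    (m := (k + N, 0)) (k := k + N) (n := 0) le_rfl le_rfl S (u, z))⟩
  rw [norm_iteratedFDeriv_zero, pow_add, mul_assoc]
  have hu : ‖u‖ ≤ 1 + ‖(u, z)‖ := (norm_fst_le (u, z)).trans (by linarith)
  have hz : ‖z‖ ≤ ‖(u, z)‖ := norm_snd_le (u, z)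
  gcongr

theorem SchwartzMap.exists_norm_pow_mul_le_one_add_norm_rpow (S : SchwartzMap (V × W) ℂ)
    (k : ℕ) : ∃ C : ℝ, ∀ u z, ‖u‖ ^ k * ‖S (u, z)‖ ≤
      C * (1 + ‖z‖) ^ (-((Module.finrank ℝ W + 1 : ℕ) : ℝ)) := by
  obtain ⟨C, hC⟩ := S.exists_norm_pow_mul_one_add_norm_pow_le k (Module.finrank ℝ W + 1)
  refine ⟨C, fun u z => ?_⟩
  rw [Real.rpow_neg (by positivity), Real.rpow_natCast, ← div_eq_mul_inv, le_div_iff₀ (by positivity)]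
  exact le_of_eq_of_le (by ring) (hC u z)

variable [FiniteDimensional ℝ W] [MeasurableSpace W] [BorelSpace W]
  (μ : Measure W) [μ.IsAddHaarMeasure]

theorem integrable_one_add_norm_finrank :
    Integrable (fun z : W => (1 + ‖z‖) ^ (-((Module.finrank ℝ W + 1 : ℕ) : ℝ))) μ :=
  integrable_one_add_norm (by push_cast; linarith)

theorem SchwartzMap.integrable_slice (S : SchwartzMap (V × W) ℂ) (u : V) :
    Integrable (fun z => S (u, z)) μ := by
  obtain ⟨C, hC⟩ := S.exists_norm_pow_mul_le_one_add_norm_rpow 0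
  refine ((integrable_one_add_norm_finrank μ).const_mul C).mono'
    (S.continuous.comp (by fun_prop)).aestronglyMeasurable (.of_forall fun z => ?_)
  simpa using hC u z

theorem SchwartzMap.integrable_slice_mul_exp (S : SchwartzMap (V × W) ℂ) (u : V)
    (L : W →L[ℝ] ℝ) :
    Integrable (fun z => S (u, z) * Complex.exp (Complex.I * (L z : ℝ))) μ := by
  refine (S.integrable_slice μ u).mul_bdd (c := 1)
    (by fun_prop : Continuous _).aestronglyMeasurable (.of_forall fun z => ?_)
  simp [mul_comm Complex.I, Complex.norm_exp_ofReal_mul_I]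

theorem SchwartzMap.norm_mul_norm_integral_slice_mul_exp (S : SchwartzMap (V × W) ℂ) (u : V)
    (L : W →L[ℝ] ℝ) (v : W) :
    |L v| * ‖∫ z, S (u, z) * Complex.exp (Complex.I * (L z : ℝ)) ∂μ‖ =
      ‖∫ z, (LineDeriv.lineDerivOp ((0, v) : V × W) S) (u, z) *
        Complex.exp (Complex.I * (L z : ℝ)) ∂μ‖ := by
  have hS : ∀ z, HasFDerivAt (fun z => S (u, z))
      ((fderiv ℝ S (u, z)).comp (ContinuousLinearMap.inr ℝ V W)) z := fun z =>
    ((S.differentiable) (u, z)).hasFDerivAt.comp z (hasFDerivAt_prodMk_right u z)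
  have hE : ∀ z, HasFDerivAt (fun z => Complex.exp (Complex.I * (L z : ℝ)))
      (Complex.exp (Complex.I * (L z : ℝ)) • (Complex.I • (Complex.ofRealCLM.comp L))) z :=
    fun z => ((Complex.ofRealCLM.comp L).hasFDerivAt.const_mul Complex.I).cexp
  have key := integral_bilinear_hasFDerivAt_right_eq_neg_left_of_integrable (μ := μ) (v := v)
    (B := ContinuousLinearMap.mul ℝ ℂ) (f := fun z => S (u, z))
    (g := fun z => Complex.exp (Complex.I * (L z : ℝ)))
    ((SchwartzMap.integrable_slice_mul_exp μ (LineDeriv.lineDerivOp ((0, v) : V × W) S) u L).congr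
      (.of_forall fun z => by simp [SchwartzMap.lineDerivOp_apply_eq_fderiv]))
    (((S.integrable_slice_mul_exp μ u L).mul_const (Complex.I * (L v : ℝ))).congr
      (.of_forall fun z => by simp; ring))
    (S.integrable_slice_mul_exp μ u L) (fun z _ => hS z) (fun z _ => hE z)
  have h1 : ∫ z, S (u, z) * Complex.exp (Complex.I * (L z : ℝ)) * (Complex.I * (L v : ℝ)) ∂μ =
      -∫ z, (LineDeriv.lineDerivOp ((0, v) : V × W) S) (u, z) *
        Complex.exp (Complex.I * (L z : ℝ)) ∂μ := by
    refine Eq.trans (integral_congr_ae (.of_forall fun z => ?_)) (key.trans ?_)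
    · simp
      ring
    · simp [SchwartzMap.lineDerivOp_apply_eq_fderiv]
  rw [integral_mul_const] at h1
  have h2 := congrArg norm h1
  rw [norm_neg] at h2
  rw [← h2]
  simp [mul_comm]

/-- Partial Fourier integrals of a Schwartz function decay rapidly in the parameter and in the
frequency, uniformly. -/
theorem SchwartzMap.exists_norm_integral_slice_mul_exp_le (S : SchwartzMap (V × W) ℂ)
    (v : W) (k m : ℕ) : ∃ C : ℝ, ∀ (u : V) (L : W →L[ℝ] ℝ),
      ‖u‖ ^ k * (|L v| ^ m * ‖∫ z, S (u, z) * Complex.exp (Complex.I * (L z : ℝ)) ∂μ‖) ≤ C := by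
  induction m generalizing S with
  | zero =>
    obtain ⟨C, hC⟩ := S.exists_norm_pow_mul_le_one_add_norm_rpow k
    refine ⟨∫ z, C * (1 + ‖z‖) ^ (-((Module.finrank ℝ W + 1 : ℕ) : ℝ)) ∂μ, fun u L => ?_⟩
    have h0 : ‖u‖ ^ k = ‖((‖u‖ ^ k : ℝ) : ℂ)‖ := by simp
    rw [pow_zero, one_mul, h0, ← norm_mul, ← integral_const_mul]
    refine norm_integral_le_of_norm_le ((integrable_one_add_norm_finrank μ).const_mul C)
      (.of_forall fun z => ?_)
    simpa [mul_comm Complex.I, Complex.norm_exp_ofReal_mul_I] using hC u z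
  | succ m ih =>
    obtain ⟨C, hC⟩ := ih (LineDeriv.lineDerivOp ((0, v) : V × W) S)
    refine ⟨C, fun u L => ?_⟩
    rw [pow_succ, mul_assoc (|L v| ^ m), S.norm_mul_norm_integral_slice_mul_exp μ]
    exact hC u L

end OscillatoryIntegral

section Tensor

variable {V W : Type*} [NormedAddCommGroup V] [NormedSpace ℝ V]
  [NormedAddCommGroup W] [NormedSpace ℝ W]

theorem SchwartzMap.exists_norm_pow_mul_norm_iteratedFDeriv_comp_mul_le
    (F : SchwartzMap V ℂ) (G : SchwartzMap W ℂ) (k n : ℕ) :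
    ∃ C : ℝ, ∀ p : V × W,
      ‖p‖ ^ k * ‖iteratedFDeriv ℝ n (fun p : V × W => F p.1 * G p.2) p‖ ≤ C := by
  have hF : ∀ (p : V × W) (i : ℕ), ‖iteratedFDeriv ℝ i (fun p : V × W => F p.1) p‖ ≤
      ‖iteratedFDeriv ℝ i F p.1‖ := fun p i => by
    have := (ContinuousLinearMap.fst ℝ V W).iteratedFDeriv_comp_right (F.smooth ⊤) p
      (i := i) (mod_cast le_top)
    refine (congrArg norm this).trans_le
      ((ContinuousMultilinearMap.norm_compContinuousLinearMap_le _ _).trans ?_)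
    exact mul_le_of_le_one_right (norm_nonneg _)
      (Finset.prod_le_one (fun _ _ => norm_nonneg _)
        fun _ _ => ContinuousLinearMap.norm_fst_le ℝ V W)
  have hG : ∀ (p : V × W) (i : ℕ), ‖iteratedFDeriv ℝ i (fun p : V × W => G p.2) p‖ ≤
      ‖iteratedFDeriv ℝ i G p.2‖ := fun p i => by
    have := (ContinuousLinearMap.snd ℝ V W).iteratedFDeriv_comp_right (G.smooth ⊤) p
      (i := i) (mod_cast le_top)
    refine (congrArg norm this).trans_le
      ((ContinuousMultilinearMap.norm_compContinuousLinearMap_le _ _).trans ?_)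
    exact mul_le_of_le_one_right (norm_nonneg _)
      (Finset.prod_le_one (fun _ _ => norm_nonneg _)
        fun _ _ => ContinuousLinearMap.norm_snd_le ℝ V W)
  choose CF hCF0 hCF using fun k i => F.decay k i
  choose CG hCG0 hCG using fun k i => G.decay k i
  refine ⟨∑ i ∈ Finset.range (n + 1), (n.choose i : ℝ) *
    (CF k i * CG 0 (n - i) + CF 0 i * CG k (n - i)), fun p => ?_⟩
  have hmul := norm_iteratedFDeriv_mul_le (𝕜 := ℝ) (f := fun p : V × W => F p.1)
    (g := fun p : V × W => G p.2) (N := (⊤ : ℕ∞))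
    ((F.smooth ⊤).comp contDiff_fst) ((G.smooth ⊤).comp contDiff_snd) p (n := n)
    (mod_cast le_top)
  refine (mul_le_mul_of_nonneg_left hmul (by positivity)).trans ?_
  rw [Finset.mul_sum]
  refine Finset.sum_le_sum fun i _ => ?_
  have hp : ‖p‖ ^ k ≤ ‖p.1‖ ^ k + ‖p.2‖ ^ k := by
    rcases max_cases ‖p.1‖ ‖p.2‖ with h | h <;> rw [Prod.norm_def, h.1] <;> simp
  have f0 := hCF 0 i p.1
  have fk := hCF k i p.1
  have g0 := hCG 0 (n - i) p.2
  have gk := hCG k (n - i) p.2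
  rw [pow_zero, one_mul] at f0 g0
  calc ‖p‖ ^ k * ((n.choose i : ℝ) * ‖iteratedFDeriv ℝ i (fun p : V × W => F p.1) p‖ *
        ‖iteratedFDeriv ℝ (n - i) (fun p : V × W => G p.2) p‖)
      ≤ (‖p.1‖ ^ k + ‖p.2‖ ^ k) * ((n.choose i : ℝ) * ‖iteratedFDeriv ℝ i F p.1‖ *
        ‖iteratedFDeriv ℝ (n - i) G p.2‖) := by
        gcongr
        · exact hF p i
        · exact hG p (n - i)
    _ = (n.choose i : ℝ) * ((‖p.1‖ ^ k * ‖iteratedFDeriv ℝ i F p.1‖) *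
          ‖iteratedFDeriv ℝ (n - i) G p.2‖ + ‖iteratedFDeriv ℝ i F p.1‖ *
          (‖p.2‖ ^ k * ‖iteratedFDeriv ℝ (n - i) G p.2‖)) := by ring
    _ ≤ _ := by
        gcongr
        · exact (hCF0 _ _).le
        · exact (hCF0 _ _).le

/-- The tensor product of two scalar Schwartz functions. -/
def SchwartzMap.tensorMul (F : SchwartzMap V ℂ) (G : SchwartzMap W ℂ) :
    SchwartzMap (V × W) ℂ where
  toFun p := F p.1 * G p.2
  smooth' := ((F.smooth ⊤).comp contDiff_fst).mul ((G.smooth ⊤).comp contDiff_snd)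
  decay' := F.exists_norm_pow_mul_norm_iteratedFDeriv_comp_mul_le G

end Tensor

theorem exists_sqrt_sum_sq_pow_mul_le {ι X : Type*} [Fintype ι] [Nonempty ι] (f : ι → X → ℝ)
    (c : X → ℝ) (hc : ∀ x, 0 ≤ c x) (n : ℕ) (h : ∀ j, ∃ C : ℝ, ∀ x, |f j x| ^ n * c x ≤ C) :
    ∃ C : ℝ, ∀ x, Real.sqrt (∑ j, f j x ^ 2) ^ n * c x ≤ C := by
  choose C hC using h
  refine ⟨Real.sqrt (Fintype.card ι) ^ n * ∑ j, |C j|, fun x => ?_⟩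
  obtain ⟨j, hj⟩ := Finite.exists_max fun j => |f j x|
  have h1 : ∑ i, f i x ^ 2 ≤ Fintype.card ι * |f j x| ^ 2 := by
    have : ∀ i ∈ Finset.univ, f i x ^ 2 ≤ |f j x| ^ 2 := fun i _ => by
      rw [← sq_abs (f i x)]
      exact pow_le_pow_left₀ (abs_nonneg _) (hj i) 2
    simpa using Finset.sum_le_card_nsmul _ _ _ this
  have h2 : Real.sqrt (∑ i, f i x ^ 2) ≤ Real.sqrt (Fintype.card ι) * |f j x| := by
    refine (Real.sqrt_le_sqrt h1).trans_eq ?_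
    rw [Real.sqrt_mul (by positivity), Real.sqrt_sq (abs_nonneg _)]
  calc Real.sqrt (∑ i, f i x ^ 2) ^ n * c x
      ≤ (Real.sqrt (Fintype.card ι) * |f j x|) ^ n * c x := by
        gcongr
        exact hc x
    _ = Real.sqrt (Fintype.card ι) ^ n * (|f j x| ^ n * c x) := by rw [mul_pow, mul_assoc]
    _ ≤ _ := by
        gcongr
        exact (hC j x).trans ((le_abs_self _).trans
          (Finset.single_le_sum (f := fun j => |C j|) (fun i _ => abs_nonneg _) (Finset.mem_univ j)))

/-- The linear automorphism `(u, z) ↦ (u + z, z)`. -/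
def shearEquiv (E : Type*) [NormedAddCommGroup E] [NormedSpace ℝ E] : (E × E) ≃L[ℝ] E × E :=
  ContinuousLinearEquiv.equivOfInverse
    ((ContinuousLinearMap.fst ℝ E E + ContinuousLinearMap.snd ℝ E E).prod
      (ContinuousLinearMap.snd ℝ E E))
    ((ContinuousLinearMap.fst ℝ E E - ContinuousLinearMap.snd ℝ E E).prod
      (ContinuousLinearMap.snd ℝ E E))
    (fun p => by simp) (fun p => by simp)

theorem IsWindow.hasCompactSupport_mul {d : ℕ} {g : E1 d → ℝ} (hg : IsWindow d g) :
    HasCompactSupport fun z : E2 d => ((g z.1 * g z.2 : ℝ) : ℂ) := by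
  refine HasCompactSupport.intro
    (hg.compactSupport.isCompact.prod hg.compactSupport.isCompact) fun z hz => ?_
  rw [Set.mem_prod, not_and_or] at hz
  rcases hz with h | h <;> simp [image_eq_zero_of_notMem_tsupport h]

theorem IsWindow.contDiff_mul {d : ℕ} {g : E1 d → ℝ} (hg : IsWindow d g) :
    ContDiff ℝ (⊤ : ℕ∞) fun z : E2 d => ((g z.1 * g z.2 : ℝ) : ℂ) :=
  Complex.ofRealCLM.contDiff.comp
    ((hg.smooth.comp contDiff_fst).mul (hg.smooth.comp contDiff_snd))

/-- The magnetic phase `φ(v + y, v) − φ(u + x, u)` at `((u, v), (x, y))`. -/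
def gaborPhase (d : ℕ) (B : Fin d → Fin d → E1 d → ℝ) (q : E4 d) : ℝ :=
  magPhi d B (q.1.2 + q.2.2) q.1.2 - magPhi d B (q.1.1 + q.2.1) q.1.1

theorem hasTemperateGrowth_gaborPhase {d : ℕ} {B : Fin d → Fin d → E1 d → ℝ}
    (hB : IsRegularMagneticField d B) : (gaborPhase d B).HasTemperateGrowth := by
  have h1 := (hasTemperateGrowth_magPhi hB).comp (ContinuousLinearMap.hasTemperateGrowth
    ((((ContinuousLinearMap.fst ℝ (E1 d) (E1 d)).comp (ContinuousLinearMap.fst ℝ (E2 d) (E2 d))) +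
      ((ContinuousLinearMap.fst ℝ (E1 d) (E1 d)).comp (ContinuousLinearMap.snd ℝ (E2 d) (E2 d)))).prod
      ((ContinuousLinearMap.fst ℝ (E1 d) (E1 d)).comp (ContinuousLinearMap.fst ℝ (E2 d) (E2 d)))))
  have h2 := (hasTemperateGrowth_magPhi hB).comp (ContinuousLinearMap.hasTemperateGrowth
    ((((ContinuousLinearMap.snd ℝ (E1 d) (E1 d)).comp (ContinuousLinearMap.fst ℝ (E2 d) (E2 d))) +
      ((ContinuousLinearMap.snd ℝ (E1 d) (E1 d)).comp (ContinuousLinearMap.snd ℝ (E2 d) (E2 d)))).prod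
      ((ContinuousLinearMap.snd ℝ (E1 d) (E1 d)).comp (ContinuousLinearMap.fst ℝ (E2 d) (E2 d)))))
  exact h2.sub h1

/-- The functional `(x, y) ↦ η·y − ξ·x`. -/
def gaborFrequency {d : ℕ} (ξ η : E1 d) : E2 d →L[ℝ] ℝ :=
  ∑ i, (η i • (ContinuousLinearMap.proj (R := ℝ) (φ := fun _ : Fin d => ℝ) i).comp
      (ContinuousLinearMap.snd ℝ (E1 d) (E1 d)) -
    ξ i • (ContinuousLinearMap.proj (R := ℝ) (φ := fun _ : Fin d => ℝ) i).comp
      (ContinuousLinearMap.fst ℝ (E1 d) (E1 d)))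

theorem gaborFrequency_apply {d : ℕ} (ξ η : E1 d) (z : E2 d) :
    gaborFrequency ξ η z = ∑ i, η i * z.2 i - ∑ i, ξ i * z.1 i := by
  simp [gaborFrequency]

theorem gaborFrequency_single_fst {d : ℕ} (ξ η : E1 d) (i : Fin d) :
    |gaborFrequency ξ η (Pi.single i 1, 0)| = |ξ i| := by
  simp [gaborFrequency_apply, Pi.single_apply]

theorem gaborFrequency_single_snd {d : ℕ} (ξ η : E1 d) (i : Fin d) :
    |gaborFrequency ξ η (0, Pi.single i 1)| = |η i| := by
  simp [gaborFrequency_apply, Pi.single_apply]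

theorem conj_exp_I_mul_ofReal (t : ℝ) :
    (starRingEnd ℂ) (Complex.exp (Complex.I * t)) = Complex.exp (-(Complex.I * t)) := by
  rw [← Complex.exp_conj]
  simp

instance isAddHaarMeasure_volume_E2 (d : ℕ) : (volume : Measure (E2 d)).IsAddHaarMeasure :=
  Measure.prod.instIsAddHaarMeasure (volume : Measure (E1 d)) (volume : Measure (E1 d))

/-- Each frame coefficient is a partial Fourier integral of one fixed Schwartz function. -/
theorem exists_schwartzMap_frameCoef_eq {d : ℕ} {B : Fin d → Fin d → E1 d → ℝ}
    (hB : IsRegularMagneticField d B) {g : E1 d → ℝ} (hg : IsWindow d g)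
    (F : SchwartzMap (E2 d) ℂ) :
    ∃ S : SchwartzMap (E2 d × E2 d) ℂ, ∀ a b : Idx d, frameCoef d B g a b ⇑F =
      ∫ z : E2 d, S ((fun i => (a.1 i : ℝ), fun i => (b.1 i : ℝ)), z) *
        Complex.exp (Complex.I *
          (gaborFrequency (fun i => (a.2 i : ℝ)) (fun i => (b.2 i : ℝ)) z : ℝ)) := by
  have hθ : (fun q : E4 d => Complex.exp (Complex.I * (gaborPhase d B q : ℝ))).HasTemperateGrowth :=
    Complex.hasTemperateGrowth_exp_I_mul_ofReal.comp (hasTemperateGrowth_gaborPhase hB)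
  let c : ℂ := (((2 * Real.pi) ^ (-(d : ℝ) / 2) : ℝ) : ℂ)
  let G : SchwartzMap (E2 d) ℂ := hg.hasCompactSupport_mul.toSchwartzMap hg.contDiff_mul
  let S : SchwartzMap (E2 d × E2 d) ℂ := SchwartzMap.smulLeftCLM ℂ
    (fun q : E4 d => Complex.exp (Complex.I * (gaborPhase d B q : ℝ)))
    (SchwartzMap.compCLMOfContinuousLinearEquiv ℂ (shearEquiv (E2 d)) (F.tensorMul G))
  have hS : ∀ u z, S (u, z) = Complex.exp (Complex.I * (gaborPhase d B (u, z) : ℝ)) *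
      (F (u + z) * ((g z.1 * g z.2 : ℝ) : ℂ)) := fun u z => by
    rw [SchwartzMap.smulLeftCLM_apply_apply hθ, smul_eq_mul]
    rfl
  refine ⟨(c * c) • S, fun a b => ?_⟩
  rw [frameCoef, ← integral_add_left_eq_self _
    (((fun i => (a.1 i : ℝ)), fun i => (b.1 i : ℝ)) : E2 d)]
  refine integral_congr_ae (.of_forall fun z => ?_)
  have ha : ((fun i => (a.1 i : ℝ)) + z.1) - (fun i => (a.1 i : ℝ)) = z.1 := add_sub_cancel_left _ _
  have hb : ((fun i => (b.1 i : ℝ)) + z.2) - (fun i => (b.1 i : ℝ)) = z.2 := add_sub_cancel_left _ _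
  simp only [smul_apply, hS, gabor, map_mul, conj_exp_I_mul_ofReal, Complex.conj_ofReal, ha, hb,
    Prod.fst_add, Prod.snd_add, Pi.add_apply, smul_eq_mul, add_sub_cancel_left,
    gaborFrequency_apply, gaborPhase, Complex.ofReal_mul, Complex.ofReal_sub, mul_sub, c]
  simp only [sub_eq_add_neg, Complex.exp_add]
  ring

theorem exists_norm_index_pow_mul_frameCoef_le {d : ℕ} {B : Fin d → Fin d → E1 d → ℝ}
    (hB : IsRegularMagneticField d B) {g : E1 d → ℝ} (hg : IsWindow d g)
    (F : SchwartzMap (E2 d) ℂ) (v : E2 d) (k m : ℕ) :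
    ∃ C : ℝ, ∀ a b : Idx d,
      ‖((fun i => (a.1 i : ℝ), fun i => (b.1 i : ℝ)) : E2 d)‖ ^ k *
      (|gaborFrequency (fun i => (a.2 i : ℝ)) (fun i => (b.2 i : ℝ)) v| ^ m *
        ‖frameCoef d B g a b ⇑F‖) ≤ C := by
  obtain ⟨S, hS⟩ := exists_schwartzMap_frameCoef_eq hB hg F
  obtain ⟨C, hC⟩ := S.exists_norm_integral_slice_mul_exp_le volume v k m
  refine ⟨C, fun a b => ?_⟩
  rw [hS a b]
  exact hC _ _

/-- The coordinates of `(1, α̃, β̃)`, indexed by a finite type. -/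
def idxPairCoord {d : ℕ} (j : Option ((Fin d ⊕ Fin d) ⊕ (Fin d ⊕ Fin d)))
    (p : Idx d × Idx d) : ℝ :=
  match j with
  | none => 1
  | some (.inl (.inl i)) => p.1.1 i
  | some (.inl (.inr i)) => p.1.2 i
  | some (.inr (.inl i)) => p.2.1 i
  | some (.inr (.inr i)) => p.2.2 i

theorem jbIdxPair_eq_sqrt_sum {d : ℕ} (a b : Idx d) :
    jbIdxPair d a b = Real.sqrt (∑ j, idxPairCoord j (a, b) ^ 2) := by
  simp [jbIdxPair, Fintype.sum_option, Fintype.sum_sum_type, idxPairCoord, add_assoc]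

/-- for Schwartz `F`, the frame coefficients decay super-polynomially. -/
theorem statement8 (d : ℕ) (hd : 0 < d) (B : Fin d → Fin d → (Fin d → ℝ) → ℝ)
    (hB : IsRegularMagneticField d B) (g : (Fin d → ℝ) → ℝ) (hg : IsWindow d g)
    (F : SchwartzMap (E2 d) ℂ) (n : ℕ) :
    ∃ C : ℝ, ∀ a b : Idx d, jbIdxPair d a b ^ n * ‖frameCoef d B g a b ⇑F‖ ≤ C := by
  obtain ⟨C, hC⟩ := exists_sqrt_sum_sq_pow_mul_le (idxPairCoord (d := d))
    (fun p => ‖frameCoef d B g p.1 p.2 ⇑F‖) (fun p => norm_nonneg _) n (fun j => by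
      rcases j with _ | ((i | i) | (i | i))
      · obtain ⟨C, hC⟩ := exists_norm_index_pow_mul_frameCoef_le hB hg F 0 0 0
        exact ⟨C, fun p => by simpa [idxPairCoord] using hC p.1 p.2⟩
      · obtain ⟨C, hC⟩ := exists_norm_index_pow_mul_frameCoef_le hB hg F 0 n 0
        refine ⟨C, fun p => le_trans ?_ (hC p.1 p.2)⟩
        rw [pow_zero, one_mul]
        gcongr
        exact (norm_le_pi_norm (fun i => (p.1.1 i : ℝ)) i).trans (norm_fst_le
          ((fun i => (p.1.1 i : ℝ), fun i => (p.2.1 i : ℝ)) : E2 d))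
      · obtain ⟨C, hC⟩ := exists_norm_index_pow_mul_frameCoef_le hB hg F (Pi.single i 1, 0) 0 n
        refine ⟨C, fun p => le_trans (le_of_eq ?_) (hC p.1 p.2)⟩
        rw [gaborFrequency_single_fst, pow_zero, one_mul, idxPairCoord]
      · obtain ⟨C, hC⟩ := exists_norm_index_pow_mul_frameCoef_le hB hg F 0 n 0
        refine ⟨C, fun p => le_trans ?_ (hC p.1 p.2)⟩
        rw [pow_zero, one_mul]
        gcongr
        exact (norm_le_pi_norm (fun i => (p.2.1 i : ℝ)) i).trans (norm_snd_le
          ((fun i => (p.1.1 i : ℝ), fun i => (p.2.1 i : ℝ)) : E2 d))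
      · obtain ⟨C, hC⟩ := exists_norm_index_pow_mul_frameCoef_le hB hg F (0, Pi.single i 1) 0 n
        refine ⟨C, fun p => le_trans (le_of_eq ?_) (hC p.1 p.2)⟩
        rw [gaborFrequency_single_snd, pow_zero, one_mul, idxPairCoord])
  refine ⟨C, fun a b => ?_⟩
  rw [jbIdxPair_eq_sqrt_sum]
  exact hC (a, b)
end
end
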